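/- The full (n, k) code obtained by appending Class B parity nodes to the Class A code has fault tolerance at least n − n_B − τ + 1 = n_A − k − τ + 1. Precisely: assume the MDS condition holds. Let m ≥ 0, n = n_A + m, n_B = k + m, and let f_1, …, f_m be arbitrary functions from k×k data matrices over F to F^k (each Class B parity node is some function of the data). Define the full encoding of a data matrix D as the k×n array whose first n_A columns form the Class A code array of D and whose column n_A + t − 1 equals f_t(D) for t = 1, …, m. Then for every set E ⊆ {0, …, n − 1} of column indices with |E| ≤ n_A − k − τ + 1, and for all data matrices D, D′, if the full code arrays of D and D′ agree on every column not in E, then D = D′. -/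

import Mathlib

/-- The Class A encoding: maps a `k × k` data matrix `D` over `F` to the `k × nA` code array.
Column `j < k` stores the data; columns `k ≤ j < nA - τ` are MDS parity columns; columns
`nA - τ ≤ j < nA` are MDS parity columns with a piggyback `d_{(i+j-nA+τ+1) mod k, i}` added. -/
def classACode (F : Type*) [Field F] (k nA τ : ℕ) (hk : 0 < k)
    (α : Fin k → Fin nA → F) (D : Fin k → Fin k → F) : Fin k → Fin nA → F :=
  fun i j =>
    if hj : (j : ℕ) < k then D i ⟨j, hj⟩
    else if (j : ℕ) < nA - τ then ∑ l : Fin k, α l j * D i l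
    else (∑ l : Fin k, α l j * D i l)
      + D ⟨((i : ℕ) + (j : ℕ) + τ + 1 - nA) % k, Nat.mod_lt _ hk⟩ i

/-- The `k × nA` matrix whose first `k` columns are the standard basis vectors of `F^k`
and whose column `j ≥ k` is `(α_{0,j}, …, α_{k-1,j})ᵀ`. -/
def mdsMat (F : Type*) [Field F] (k nA : ℕ) (α : Fin k → Fin nA → F) :
    Matrix (Fin k) (Fin nA) F :=
  fun i j => if (j : ℕ) < k then (if (i : ℕ) = (j : ℕ) then 1 else 0) else α i j

/-- The MDS condition: every `k` columns of `mdsMat` are linearly independent. -/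
def MDSCondition (F : Type*) [Field F] (k nA : ℕ) (α : Fin k → Fin nA → F) : Prop :=
  ∀ S : Finset (Fin nA), S.card = k →
    LinearIndependent F (fun j : {x // x ∈ S} => fun i : Fin k => mdsMat F k nA α i j.1)

/-- The full `(n, k)` code, `n = nA + m`: the first `nA` columns form the Class A code
array of `D`, and column `nA + t` is the (arbitrary) Class B parity node `f t` applied
to `D`, for `t = 0, …, m - 1`. -/
def fullCode (F : Type*) [Field F] (k nA τ m : ℕ) (hk : 0 < k)
    (α : Fin k → Fin nA → F)
    (f : Fin m → (Fin k → Fin k → F) → (Fin k → F))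
    (D : Fin k → Fin k → F) : Fin k → Fin (nA + m) → F :=
  fun i j =>
    if hj : (j : ℕ) < nA then classACode F k nA τ hk α D i ⟨j, hj⟩
    else f ⟨(j : ℕ) - nA, by have := j.isLt; omega⟩ D i

theorem mds_row_zero (F : Type*) [Field F] (k nA : ℕ) (α : Fin k → Fin nA → F)
    (hMDS : MDSCondition F k nA α) (T : Finset (Fin nA)) (hT : k ≤ T.card)
    (x : Fin k → F) (hx : ∀ j ∈ T, ∑ l, mdsMat F k nA α l j * x l = 0) : x = 0 := by
  obtain ⟨S, hST, hS⟩ := Finset.exists_subset_card_eq hT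
  have hli := hMDS S hS
  have hsp := hli.span_eq_top_of_card_eq_finrank' (by simp [hS])
  have key : ∀ v : Fin k → F, ∑ l, v l * x l = 0 := by
    intro v
    have hv : v ∈ Submodule.span F (Set.range
        (fun j : {x // x ∈ S} => fun i : Fin k => mdsMat F k nA α i j.1)) := by
      rw [hsp]; trivial
    induction hv using Submodule.span_induction with
    | mem v h =>
      obtain ⟨j, rfl⟩ := h
      exact hx j.1 (hST j.2)
    | zero => simp
    | add a b _ _ ha hb => simp [add_mul, Finset.sum_add_distrib, ha, hb]
    | smul c a _ ha => simp [mul_assoc, ← Finset.mul_sum, ha]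
  funext i
  simpa [Pi.single_apply] using key (Pi.single i 1)

/-- The full `(n, k)` code obtained by appending `m` arbitrary Class B parity
nodes to the Class A code has fault tolerance at least `n - n_B - τ + 1 = nA - k - τ + 1`:
if the MDS condition holds, then for any set `E` of at most `nA - k - τ + 1` column (node)
indices of the full code, any two data matrices whose full code arrays agree on every
column outside `E` must be equal. -/
theorem fullCode_fault_tolerance (F : Type*) [Field F] (k nA τ : ℕ)
    (hk : 3 ≤ k) (hnA1 : k + 2 ≤ nA) (hnA2 : nA ≤ 2 * k - 1)
    (hτ1 : 1 ≤ τ) (hτ2 : τ ≤ nA - k - 1)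
    (α : Fin k → Fin nA → F) (hMDS : MDSCondition F k nA α)
    (m : ℕ) (f : Fin m → (Fin k → Fin k → F) → (Fin k → F)) :
    ∀ E : Finset (Fin (nA + m)), E.card ≤ nA - k - τ + 1 →
      ∀ D D' : Fin k → Fin k → F,
        (∀ (i : Fin k) (j : Fin (nA + m)), j ∉ E →
          fullCode F k nA τ m (by omega) α f D i j
            = fullCode F k nA τ m (by omega) α f D' i j) →
        D = D' := by
  intro E hE D D' h
  have hk0 : 0 < k := by omega
  have hA : ∀ (i : Fin k) (j : Fin nA), Fin.castAdd m j ∉ E →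
      classACode F k nA τ hk0 α D i j = classACode F k nA τ hk0 α D' i j := by
    intro i j hj
    have := h i _ hj
    simpa [fullCode] using this
  -- surviving columns among the first `nA - τ + 1`
  let T : Finset (Fin nA) :=
    Finset.univ.filter (fun j => (j : ℕ) < nA - τ + 1 ∧ Fin.castAdd m j ∉ E)
  have hT : k ≤ T.card := by
    let U : Finset (Fin nA) := Finset.univ.filter (fun j => (j : ℕ) < nA - τ + 1)
    have hU : U.card = nA - τ + 1 := by
      have := Fin.card_filter_val_lt (n := nA) (m := nA - τ + 1)
      simp only [U]
      rw [this]; omega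
    let V : Finset (Fin nA) := Finset.univ.filter (fun j => Fin.castAdd m j ∈ E)
    have hV : V.card ≤ E.card :=
      Finset.card_le_card_of_injOn (Fin.castAdd m) (by intro j hj; simpa [V] using hj)
        (fun a _ b _ hab => by simpa using hab)
    have hUT : U ⊆ T ∪ V := by
      intro j hj
      simp only [U, T, V, Finset.mem_union, Finset.mem_filter, Finset.mem_univ, true_and] at *
      tauto
    have h1 := Finset.card_le_card hUT
    have h2 := Finset.card_union_le T V
    omega
  have hstep : ∀ i : Fin k, D ⟨(i + 1) % k, Nat.mod_lt _ hk0⟩ i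
      = D' ⟨(i + 1) % k, Nat.mod_lt _ hk0⟩ i → D i = D' i := by
    intro i hi
    have : (D i - D' i) = 0 := by
      refine mds_row_zero F k nA α hMDS T hT _ ?_
      intro j hj
      simp only [T, Finset.mem_filter, Finset.mem_univ, true_and] at hj
      have hc := hA i j hj.2
      unfold classACode at hc
      unfold mdsMat
      by_cases hjk : (j : ℕ) < k
      · simp only [hjk, dite_true] at hc
        rw [Finset.sum_eq_single (⟨j, hjk⟩ : Fin k)]
        · simp [hjk, hc]
        · intro b _ hb
          have : (b : ℕ) ≠ j := fun h => hb (Fin.ext h)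
          simp [hjk, this]
        · simp
      · simp only [hjk, dite_false, if_false] at hc ⊢
        simp only [Pi.sub_apply, mul_sub, Finset.sum_sub_distrib]
        rw [sub_eq_zero]
        by_cases hj2 : (j : ℕ) < nA - τ
        · simpa [hj2] using hc
        · simp only [hj2, if_false] at hc
          have e : (i : ℕ) + j + τ + 1 - nA = i + 1 := by omega
          simp only [e, hi] at hc
          exact add_right_cancel hc
    exact sub_eq_zero.mp this
  obtain ⟨i0, hi0⟩ : ∃ i0 : Fin k, ∀ i, D i i0 = D' i i0 := by
    by_contra hcon
    push Not at hcon
    have : (Finset.univ : Finset (Fin k)).card ≤ E.card := by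
      refine Finset.card_le_card_of_injOn
        (fun i => (⟨i, by omega⟩ : Fin (nA + m))) ?_ ?_
      · intro i _
        by_contra hi
        obtain ⟨r, hr⟩ := hcon i
        have := hA r ⟨i, by omega⟩ hi
        exact hr (by simpa [classACode] using this)
      · intro a _ b _ hab
        simpa [Fin.ext_iff] using hab
    simp at this
    omega
  have hall : ∀ t : ℕ, ∀ i : Fin k, ((i : ℕ) + t) % k = i0 → D i = D' i := by
    intro t
    induction t with
    | zero =>
      intro i hi
      have : i = i0 := by
        apply Fin.ext
        rw [← hi, Nat.add_zero, Nat.mod_eq_of_lt i.2]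
      subst this
      exact hstep i (hi0 _)
    | succ t ih =>
      intro i hi
      refine hstep i ?_
      rw [ih ⟨(i + 1) % k, Nat.mod_lt _ hk0⟩ ?_]
      rw [← hi]
      simp only [Nat.mod_add_mod]
      congr 1
      omega
  funext i
  refine hall (i0 + k - i) i ?_
  have : (i : ℕ) + (i0 + k - i) = i0 + k := by omega
  rw [this, Nat.add_mod_right, Nat.mod_eq_of_lt i0.2]
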